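/- Let G be a finite simple graph with n vertices in which every vertex has at least one neighbour, and suppose that Γ(Q(G)) ≥ 3. Then Γ(Q(G)) = n − γ(G). -/

import Mathlib

/-- A set `D` of vertices is dominating if every vertex not in `D` has a neighbour in `D`. -/
def Dominating {V : Type*} (G : SimpleGraph V) (D : Set V) : Prop :=
  ∀ v ∉ D, ∃ u ∈ D, G.Adj u v

/-- `D` is a minimal dominating set if it is dominating and no proper subset is dominating. -/
def MinimalDominating {V : Type*} (G : SimpleGraph V) (D : Set V) : Prop :=
  Dominating G D ∧ ∀ D' ⊂ D, ¬ Dominating G D'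

/-- `Γ(G)`: the maximum cardinality of a minimal dominating set (upper domination number). -/
noncomputable def upperDomNum {V : Type*} (G : SimpleGraph V) : ℕ :=
  sSup {n | ∃ D : Set V, MinimalDominating G D ∧ D.ncard = n}

/-- `γ(G)`: the minimum cardinality of a dominating set (domination number). -/
noncomputable def domNum {V : Type*} (G : SimpleGraph V) : ℕ :=
  sInf {n | ∃ D : Set V, Dominating G D ∧ D.ncard = n}

/-- The graph `Q(G)` on the old vertices (vertices of `G`) and the new vertices (edges of
`G`): the old vertices form a clique, the new vertices form a clique, and an old vertex `v`
is adjacent to a new vertex `e` iff `v` is an endpoint of `e` in `G`. -/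
def Qgraph {V : Type*} (G : SimpleGraph V) : SimpleGraph (V ⊕ G.edgeSet) :=
  SimpleGraph.fromRel (fun x y =>
    match x, y with
    | Sum.inl _, Sum.inl _ => True
    | Sum.inr _, Sum.inr _ => True
    | Sum.inl v, Sum.inr e => v ∈ (e : Sym2 V)
    | Sum.inr _, Sum.inl _ => False)


lemma q_ll {V : Type*} (G : SimpleGraph V) (u v : V) :
    (Qgraph G).Adj (Sum.inl u) (Sum.inl v) ↔ u ≠ v := by
  simp [Qgraph, SimpleGraph.fromRel_adj]

lemma q_rr {V : Type*} (G : SimpleGraph V) (e f : G.edgeSet) :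
    (Qgraph G).Adj (Sum.inr e) (Sum.inr f) ↔ e ≠ f := by
  simp [Qgraph, SimpleGraph.fromRel_adj]

lemma q_lr {V : Type*} (G : SimpleGraph V) (v : V) (e : G.edgeSet) :
    (Qgraph G).Adj (Sum.inl v) (Sum.inr e) ↔ v ∈ (e : Sym2 V) := by
  simp [Qgraph, SimpleGraph.fromRel_adj]

lemma q_rl {V : Type*} (G : SimpleGraph V) (v : V) (e : G.edgeSet) :
    (Qgraph G).Adj (Sum.inr e) (Sum.inl v) ↔ v ∈ (e : Sym2 V) := by
  simp [Qgraph, SimpleGraph.fromRel_adj]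

lemma exists_private {V : Type*} {G : SimpleGraph V} {D : Set V} (h : MinimalDominating G D)
    {x : V} (hx : x ∈ D) :
    ∃ w, (x = w ∨ G.Adj x w) ∧ ∀ y ∈ D, (y = w ∨ G.Adj y w) → y = x := by
  have h1 := h.2 (D \ {x}) (by
    refine ⟨Set.sdiff_subset, fun hh => ?_⟩
    have := hh hx
    simp at this)
  unfold Dominating at h1
  push Not at h1
  obtain ⟨w, hw, hw2⟩ := h1
  have key : ∀ y ∈ D, (y = w ∨ G.Adj y w) → y = x := by
    intro y hy hyw
    by_contra hne
    rcases hyw with rfl | hyw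
    · exact hw ⟨hy, hne⟩
    · exact hw2 y ⟨hy, hne⟩ hyw
  refine ⟨w, ?_, key⟩
  by_cases hwD : w ∈ D
  · exact Or.inl (key w hwD (Or.inl rfl)).symm
  · obtain ⟨u, hu, huw⟩ := h.1 w hwD
    have := key u hu (Or.inr huw)
    subst this
    exact Or.inr huw

lemma card_le_of_compl {V : Type*} [Fintype V] (G : SimpleGraph V) (P : Set V)
    (h : Dominating G Pᶜ) : P.ncard ≤ Fintype.card V - domNum G := by
  have h1 : domNum G ≤ Pᶜ.ncard := Nat.sInf_le ⟨_, h, rfl⟩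
  have h2 := Set.ncard_add_ncard_compl P
  rw [Nat.card_eq_fintype_card] at h2
  omega

lemma upper_part {V : Type*} [Fintype V] (G : SimpleGraph V)
    (D : Set (V ⊕ G.edgeSet)) (hD : MinimalDominating (Qgraph G) D) (h3 : 3 ≤ D.ncard) :
    D.ncard ≤ Fintype.card V - domNum G := by
  classical
  have hfin : D.Finite := Set.toFinite D
  have hnt : ∀ x ∈ D, ∃ y ∈ D, y ≠ x := by
    intro x hx
    exact Set.exists_ne_of_one_lt_ncard (by omega) x
  have hmix : ∀ v e, Sum.inl v ∈ D → Sum.inr e ∈ D → False := by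
    intro v e hv he
    have hsub : ({Sum.inl v, Sum.inr e} : Set (V ⊕ G.edgeSet)) ⊂ D := by
      refine Set.ssubset_iff_subset_ne.2 ⟨?_, ?_⟩
      · rintro x (rfl | rfl) <;> assumption
      · intro heq
        have := Set.ncard_insert_le (Sum.inl v) ({Sum.inr e} : Set (V ⊕ G.edgeSet))
        rw [heq, Set.ncard_singleton] at this
        omega
    apply hD.2 _ hsub
    rintro (u | f) hu
    · exact ⟨Sum.inl v, by simp, (q_ll G _ _).2 (by rintro rfl; simp at hu)⟩
    · exact ⟨Sum.inr e, by simp, (q_rr G _ _).2 (by rintro rfl; simp at hu)⟩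
  by_cases hV : ∃ v, Sum.inl v ∈ D
  · obtain ⟨v0, hv0⟩ := hV
    have hDE : D = Sum.inl '' {v | Sum.inl v ∈ D} := by
      ext (x | x)
      · simp
      · simpa using fun h => hmix v0 x hv0 h
    rw [hDE, Set.ncard_image_of_injective _ Sum.inl_injective]
    apply card_le_of_compl
    intro v hv
    have hv : Sum.inl v ∈ D := by simpa using hv
    obtain ⟨w, hw, hp⟩ := exists_private hD hv
    rcases w with w | e
    · exfalso
      obtain ⟨y, hy, hne⟩ := hnt _ hv
      apply hne
      apply hp y hy
      rcases y with y | y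
      · by_cases h : y = w
        · left; rw [h]
        · right; exact (q_ll G _ _).2 h
      · exact (hmix _ _ hv hy).elim
    · have hve : v ∈ (e : Sym2 V) := by
        rcases hw with hw | hw
        · cases hw
        · exact (q_lr G _ _).1 hw
      obtain ⟨e, he⟩ := e
      obtain ⟨u, rfl⟩ := Sym2.mem_iff_exists.1 hve
      have hadj : G.Adj v u := he
      refine ⟨u, ?_, hadj.symm⟩
      intro huD
      have := hp (Sum.inl u) huD (Or.inr ((q_lr G _ _).2 (by simp)))
      exact hadj.ne (Sum.inl_injective this).symm
  · push Not at hV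
    have hpr : ∀ x : V ⊕ G.edgeSet, x ∈ D → ∃ v : V, (Qgraph G).Adj x (Sum.inl v) ∧
        ∀ y ∈ D, (Qgraph G).Adj y (Sum.inl v) → y = x := by
      intro x hx
      obtain ⟨w, hw, hp⟩ := exists_private hD hx
      rcases w with w | f
      · refine ⟨w, ?_, fun y hy h => hp y hy (Or.inr h)⟩
        rcases hw with rfl | hw
        · exact (hV _ hx).elim
        · exact hw
      · exfalso
        obtain ⟨y, hy, hne⟩ := hnt _ hx
        apply hne
        apply hp y hy
        rcases y with y | y
        · exact (hV _ hy).elim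
        · by_cases h : y = f
          · left; rw [h]
          · right; exact (q_rr G _ _).2 h
    have hne : Nonempty V := by
      obtain ⟨x, hx⟩ := Set.nonempty_of_ncard_ne_zero (s := D) (by omega)
      exact ⟨(hpr x hx).choose⟩
    choose! p hp1 hp2 using hpr
    have hinj : Set.InjOn p D := by
      intro x hx y hy hxy
      apply hp2 y hy x hx
      rw [← hxy]; exact hp1 x hx
    rw [← hinj.ncard_image]
    apply card_le_of_compl
    intro v hv
    have hv : v ∈ p '' D := Set.notMem_compl_iff.1 hv
    obtain ⟨x, hx, rfl⟩ := hv
    rcases x with x | e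
    · exact (hV _ hx).elim
    have hve := (q_rl G _ _).1 (hp1 _ hx)
    obtain ⟨u, hu⟩ := Sym2.mem_iff_exists.1 hve
    have hadj : G.Adj (p (Sum.inr e)) u := by
      have := e.2
      rw [hu] at this
      exact this
    refine ⟨u, ?_, hadj.symm⟩
    rintro ⟨y, hy, hyu⟩
    have : Sum.inr e = y := by
      apply hp2 y hy _ hx
      rw [hyu, q_rl, hu]; simp
    subst this
    exact hadj.ne hyu

lemma exists_assign {V : Type*} [Fintype V] (G : SimpleGraph V)
    (hmin : ∀ v : V, ∃ u : V, G.Adj u v) (S : Set V) (hS : Dominating G S)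
    (hc : ∀ T, Dominating G T → S.ncard ≤ T.ncard) :
    ∃ f : V → V, (∀ v ∉ S, f v ∈ S ∧ G.Adj (f v) v) ∧ ∀ s ∈ S, ∃ v ∉ S, f v = s := by
  classical
  have hout : ∀ s ∈ S, ∃ v ∉ S, G.Adj s v := by
    intro s hs
    by_contra! hno
    have hd : Dominating G (S \ {s}) := by
      intro v hv
      by_cases hvs : v = s
      · subst hvs
        obtain ⟨u, hu⟩ := hmin v
        refine ⟨u, ⟨?_, hu.ne⟩, hu⟩
        by_contra huS
        exact hno u huS hu.symm
      · have hvS : v ∉ S := fun h => hv ⟨h, hvs⟩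
        obtain ⟨u, hu, huv⟩ := hS v hvS
        refine ⟨u, ⟨hu, ?_⟩, huv⟩
        rintro rfl
        exact hno v hvS huv
    have h1 := hc _ hd
    have h2 := Set.ncard_sdiff_singleton_lt_of_mem hs
    omega
  let N : S → Finset V := fun s => Finset.univ.filter (fun v => v ∉ S ∧ G.Adj s v)
  have hall : ∀ A : Finset S, A.card ≤ (A.biUnion N).card := by
    intro A
    let A' : Set V := Subtype.val '' (A : Set S)
    have hA' : A'.ncard = A.card := by
      rw [Set.ncard_image_of_injective _ Subtype.val_injective, Set.ncard_coe_finset]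
    have hsub : A' ⊆ S := by rintro _ ⟨s, _, rfl⟩; exact s.2
    have hd : Dominating G ((S \ A') ∪ (A.biUnion N : Finset V)) := by
      intro v hv
      by_cases hvS : v ∈ S
      · have hvA : v ∈ A' := by
          by_contra h
          exact hv (Or.inl ⟨hvS, h⟩)
        obtain ⟨s, hs, rfl⟩ := hvA
        obtain ⟨u, hu, hsu⟩ := hout s s.2
        refine ⟨u, Or.inr ?_, hsu.symm⟩
        simp only [Finset.mem_coe, Finset.mem_biUnion]
        exact ⟨s, hs, by simp [N, hu, hsu]⟩
      · obtain ⟨u, hu, huv⟩ := hS v hvS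
        refine ⟨u, Or.inl ⟨hu, ?_⟩, huv⟩
        rintro ⟨s, hs, rfl⟩
        apply hv
        right
        simp only [Finset.mem_coe, Finset.mem_biUnion]
        exact ⟨s, hs, by simp [N, hvS, huv]⟩
    have h1 := hc _ hd
    have h2 := Set.ncard_union_le (S \ A') ((A.biUnion N : Finset V) : Set V)
    rw [Set.ncard_coe_finset] at h2
    have h3 := Set.ncard_sdiff_add_ncard_of_subset hsub
    omega
  obtain ⟨g, hg, hgN⟩ := (Finset.all_card_le_biUnion_card_iff_exists_injective N).1 hall
  have hgN : ∀ s, g s ∉ S ∧ G.Adj s (g s) := by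
    intro s
    simpa [N] using hgN s
  choose! f0 hf0 hf0' using hS
  refine ⟨fun v => if h : ∃ s, g s = v then (h.choose : V) else f0 v, ?_, ?_⟩
  · intro v hv
    by_cases h : ∃ s, g s = v
    · simp only [dif_pos h]
      refine ⟨h.choose.2, ?_⟩
      have := (hgN h.choose).2
      rwa [h.choose_spec] at this
    · simp only [dif_neg h]
      exact ⟨hf0 v hv, hf0' v hv⟩
  · intro s hs
    refine ⟨g ⟨s, hs⟩, (hgN _).1, ?_⟩
    have h : ∃ t, g t = g ⟨s, hs⟩ := ⟨_, rfl⟩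
    simp only [dif_pos h]
    rw [hg h.choose_spec]

lemma lower_part {V : Type*} [Fintype V] (G : SimpleGraph V)
    (hmin : ∀ v : V, ∃ u : V, G.Adj u v) :
    ∃ D, MinimalDominating (Qgraph G) D ∧ D.ncard = Fintype.card V - domNum G := by
  classical
  obtain ⟨S, hS, hcard⟩ : domNum G ∈ {n | ∃ D : Set V, Dominating G D ∧ D.ncard = n} :=
    Nat.sInf_mem ⟨_, Set.univ, fun v hv => (hv (Set.mem_univ v)).elim, rfl⟩
  obtain ⟨f, hf, hsurj⟩ := exists_assign G hmin S hS (fun T hT => by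
    rw [hcard]; exact Nat.sInf_le ⟨T, hT, rfl⟩)
  let E : (Sᶜ : Set V) → V ⊕ G.edgeSet := fun v => Sum.inr ⟨s(f v, v), (hf v v.2).2⟩
  have hE : ∀ (v w : (Sᶜ : Set V)), (Qgraph G).Adj (E w) (Sum.inl (v : V)) → w = v := by
    intro v w h
    have := (q_rl G _ _).1 h
    simp only [Sym2.mem_iff] at this
    rcases this with h | h
    · exact (v.2 (h ▸ (hf w w.2).1)).elim
    · exact Subtype.ext h.symm
  have hE' : ∀ (v : (Sᶜ : Set V)), (Qgraph G).Adj (E v) (Sum.inl (v : V)) := fun v =>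
    (q_rl G _ _).2 (by simp)
  have hinj : Function.Injective E := by
    intro v w h
    apply hE w v
    rw [h]; exact hE' w
  have hcov : ∀ v : V, ∃ w, (Qgraph G).Adj (E w) (Sum.inl v) := by
    intro v
    by_cases hv : v ∈ S
    · obtain ⟨w, hw, rfl⟩ := hsurj v hv
      exact ⟨⟨w, hw⟩, (q_rl G _ _).2 (by simp)⟩
    · exact ⟨⟨v, hv⟩, hE' ⟨v, hv⟩⟩
  refine ⟨Set.range E, ⟨?_, ?_⟩, ?_⟩
  · rintro (v | e) hx
    · obtain ⟨w, hw⟩ := hcov v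
      exact ⟨_, ⟨w, rfl⟩, hw⟩
    · obtain ⟨w, -⟩ := hcov (e : Sym2 V).out.1
      refine ⟨_, ⟨w, rfl⟩, (q_rr G _ _).2 ?_⟩
      intro h
      exact hx ⟨w, by rw [← h]⟩
  · intro D' hD' hdom
    obtain ⟨hsub, hne⟩ := hD'
    apply hne
    rintro _ ⟨v, rfl⟩
    obtain ⟨u, hu, huv⟩ := hdom (Sum.inl (v : V)) (by
      intro h
      obtain ⟨w, hw⟩ := hsub h
      cases hw)
    obtain ⟨w, rfl⟩ := hsub hu
    rwa [← hE v w huv]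
  · rw [← Set.image_univ, Set.ncard_image_of_injective _ hinj, Set.ncard_univ,
      Nat.card_coe_set_eq, ← hcard]
    have h2 := Set.ncard_add_ncard_compl S
    rw [Nat.card_eq_fintype_card] at h2
    omega

/-- If `G` is a finite graph on `n` vertices in which every vertex has a neighbour and
`Γ(Q(G)) ≥ 3`, then `Γ(Q(G)) = n - γ(G)`. -/
theorem upperDomNum_Qgraph {V : Type*} [Fintype V] (G : SimpleGraph V)
    (hmin : ∀ v : V, ∃ u : V, G.Adj u v)
    (h3 : 3 ≤ upperDomNum (Qgraph G)) :
    upperDomNum (Qgraph G) = Fintype.card V - domNum G := by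
  classical
  have hbdd : BddAbove {n | ∃ D, MinimalDominating (Qgraph G) D ∧ D.ncard = n} := by
    refine ⟨Nat.card (V ⊕ G.edgeSet), ?_⟩
    rintro _ ⟨D, -, rfl⟩
    exact Set.ncard_le_card D
  have hlow := lower_part G hmin
  apply le_antisymm
  · obtain ⟨D, hD, hc⟩ := Nat.sSup_mem ⟨_, hlow⟩ hbdd
    change D.ncard = upperDomNum (Qgraph G) at hc
    rw [← hc] at h3 ⊢
    exact upper_part G D hD h3
  · exact le_csSup hbdd hlow
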